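/- There are only finitely many 3-dicritical semi-complete digraphs (up to isomorphism). -/

import Mathlib

/-- A (loopless, simple) digraph on vertex type `V`. -/
structure SimpleDigraph (V : Type) where
  Adj : V → V → Prop
  loopless : ∀ v, ¬ Adj v v

namespace SimpleDigraph

/-- A set of arcs (given as a relation) is acyclic if it admits no directed closed walk. -/
def AcyclicRel {V : Type} (A : V → V → Prop) : Prop :=
  ∀ v, ¬ Relation.TransGen A v v

/-- A set of arcs is 2-dicolourable if the vertices can be coloured with two colours
so that each colour class induces an acyclic subdigraph. -/
def Dicolourable2Rel {V : Type} (A : V → V → Prop) : Prop :=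
  ∃ φ : V → Fin 2, ∀ i : Fin 2,
    AcyclicRel (fun a b => A a b ∧ φ a = i ∧ φ b = i)

/-- A digraph is 2-dicolourable if its vertices can be coloured with two colours
so that each colour class induces an acyclic subdigraph. -/
def Dicolourable2 {V : Type} (D : SimpleDigraph V) : Prop :=
  Dicolourable2Rel D.Adj

/-- `(S, A)` describes a subdigraph of `D`: its vertex set is `S` and its arcs
are given by `A`, which must join vertices of `S` and be arcs of `D`. -/
def IsSubdigraphOn {V : Type} (D : SimpleDigraph V) (S : Set V) (A : V → V → Prop) : Prop :=
  ∀ u v, A u v → u ∈ S ∧ v ∈ S ∧ D.Adj u v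

/-- `D` is 3-dicritical: `D` is not 2-dicolourable, but every proper subdigraph of `D`
(one missing a vertex or an arc) is 2-dicolourable. -/
def Dicritical3 {V : Type} (D : SimpleDigraph V) : Prop :=
  ¬ D.Dicolourable2 ∧
    ∀ (S : Set V) (A : V → V → Prop), D.IsSubdigraphOn S A →
      (S ≠ Set.univ ∨ A ≠ D.Adj) → Dicolourable2Rel A

/-- A digraph is semi-complete if any two distinct vertices are joined by at least one arc. -/
def SemiComplete {V : Type} (D : SimpleDigraph V) : Prop :=
  ∀ u v : V, u ≠ v → D.Adj u v ∨ D.Adj v u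

/-- A tournament is a semi-complete digraph with no digon. -/
def IsTournament {V : Type} (D : SimpleDigraph V) : Prop :=
  D.SemiComplete ∧ ∀ u v : V, ¬ (D.Adj u v ∧ D.Adj v u)

/-- Isomorphism of digraphs. -/
def Iso {V W : Type} (D : SimpleDigraph V) (E : SimpleDigraph W) : Prop :=
  ∃ e : V ≃ W, ∀ u v : V, D.Adj u v ↔ E.Adj (e u) (e v)

/-- `D` contains (a copy of) `H` as a subdigraph. -/
def ContainsSub {V W : Type} (D : SimpleDigraph V) (H : SimpleDigraph W) : Prop :=
  ∃ f : W → V, Function.Injective f ∧ ∀ a b, H.Adj a b → D.Adj (f a) (f b)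

/-- `D` contains (a copy of) `H` as an induced subdigraph. -/
def ContainsInduced {V W : Type} (D : SimpleDigraph V) (H : SimpleDigraph W) : Prop :=
  ∃ f : W → V, Function.Injective f ∧ ∀ a b, H.Adj a b ↔ D.Adj (f a) (f b)

end SimpleDigraph

/-- Large sets of naturals contain subsets on which the colour of a pair depends only on the
smaller element. -/
theorem exists_end_homogeneous (κ : Type) [Fintype κ] (m : ℕ) :
    ∃ M : ℕ, ∀ (c : ℕ → ℕ → κ) (A : Finset ℕ), M ≤ A.card →
      ∃ B ⊆ A, B.card = m ∧ ∃ d : ℕ → κ, ∀ a ∈ B, ∀ b ∈ B, a < b → c a b = d a := by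
  classical
  induction m with
  | zero =>
    exact ⟨0, fun c A _ => ⟨∅, by simp, rfl, fun a => c a a, by simp⟩⟩
  | succ m ih =>
    obtain ⟨M, hM⟩ := ih
    refine ⟨Fintype.card κ * M + 2, fun c A hA => ?_⟩
    have hne : A.Nonempty := Finset.card_pos.mp (by omega)
    set a := A.min' hne
    have ha : a ∈ A := A.min'_mem hne
    have hcard : (A.erase a).card = A.card - 1 := Finset.card_erase_of_mem ha
    obtain ⟨x, -, hx⟩ := Finset.exists_lt_card_fiber_of_mul_lt_card_of_maps_to
      (s := A.erase a) (t := Finset.univ) (f := c a) (n := M) (fun _ _ => Finset.mem_univ _)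
      (by rw [Finset.card_univ]; omega)
    obtain ⟨B, hB, hBm, d, hd⟩ := hM c _ hx.le
    have hBA : ∀ b ∈ B, (b ≠ a ∧ b ∈ A) ∧ c a b = x := fun b hb => by
      simpa using hB hb
    refine ⟨insert a B, ?_, ?_, Function.update d a x, ?_⟩
    · intro b hb
      rcases Finset.mem_insert.mp hb with rfl | hb
      · exact ha
      · exact (hBA b hb).1.2
    · rw [Finset.card_insert_of_notMem (fun h => (hBA a h).1.1 rfl), hBm]
    · intro b hb b' hb' hlt
      rcases Finset.mem_insert.mp hb with rfl | hb
      · rcases Finset.mem_insert.mp hb' with rfl | hb'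
        · exact absurd hlt (lt_irrefl _)
        · rw [Function.update_self]
          exact (hBA b' hb').2
      · rw [Function.update_of_ne (hBA b hb).1.1]
        rcases Finset.mem_insert.mp hb' with rfl | hb'
        · exact absurd hlt (not_lt.mpr (A.min'_le b (hBA b hb).1.2))
        · exact hd b hb b' hb' hlt

/-- Finite Ramsey theorem for pairs. -/
theorem exists_homogeneous (κ : Type) [Finite κ] (m : ℕ) :
    ∃ M : ℕ, ∀ c : ℕ → ℕ → κ, ∃ (f : Fin m → ℕ) (x : Set κ), StrictMono f ∧ (∀ i, f i < M) ∧
      x.Subsingleton ∧ ∀ i j, i < j → c (f i) (f j) ∈ x := by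
  classical
  have := Fintype.ofFinite κ
  obtain ⟨M, hM⟩ := exists_end_homogeneous κ (Fintype.card κ * m + 1)
  refine ⟨M, fun c => ?_⟩
  obtain ⟨B, hB, hcard, d, hd⟩ := hM c (Finset.range M) (by simp)
  obtain ⟨x, -, hx⟩ := Finset.exists_lt_card_fiber_of_mul_lt_card_of_maps_to
    (s := B) (t := Finset.univ) (f := d) (n := m) (fun _ _ => Finset.mem_univ _)
    (by rw [Finset.card_univ]; omega)
  obtain ⟨C, hC, hCm⟩ := Finset.exists_subset_card_eq hx.le
  have hCB : ∀ a ∈ C, a ∈ B ∧ d a = x := fun a ha => by simpa using hC ha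
  let f := C.orderEmbOfFin hCm
  have hf : ∀ i, f i ∈ C := C.orderEmbOfFin_mem hCm
  refine ⟨f, {x}, f.strictMono, fun i => ?_, Set.subsingleton_singleton, fun i j hij => ?_⟩
  · simpa using hB (hCB _ (hf i)).1
  · exact (hd _ (hCB _ (hf i)).1 _ (hCB _ (hf j)).1 (f.strictMono hij)).trans (hCB _ (hf i)).2

namespace SimpleDigraph

variable {V : Type} {D : SimpleDigraph V}

theorem Adj.ne {u v : V} (h : D.Adj u v) : u ≠ v := by
  rintro rfl
  exact D.loopless _ h

theorem AcyclicRel.no_triangle {A : V → V → Prop} (h : AcyclicRel A) {a b c : V}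
    (hab : A a b) (hbc : A b c) : ¬ A c a := fun hca =>
  h a (((Relation.TransGen.single hab).tail hbc).tail hca)

theorem AcyclicRel.no_digon {A : V → V → Prop} (h : AcyclicRel A) {a b : V}
    (hab : A a b) : ¬ A b a := fun hba =>
  h a ((Relation.TransGen.single hab).tail hba)

theorem transGen_insert_arc {A B : V → V → Prop} {u v : V}
    (h : ∀ a b, B a b → A a b ∨ (a = u ∧ b = v)) {x y : V} (hxy : Relation.TransGen B x y) :
    Relation.TransGen A x y ∨ (Relation.ReflTransGen A x u ∧ Relation.ReflTransGen A v y) := by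
  induction hxy with
  | single hb =>
    rcases h _ _ hb with hA | ⟨rfl, rfl⟩
    · exact Or.inl (.single hA)
    · exact Or.inr ⟨.refl, .refl⟩
  | tail _ hb ih =>
    rcases h _ _ hb with hA | ⟨rfl, rfl⟩
    · exact ih.imp (fun t => t.tail hA) (fun t => ⟨t.1, t.2.tail hA⟩)
    · rcases ih with t | t
      · exact Or.inr ⟨t.to_reflTransGen, .refl⟩
      · exact Or.inr ⟨t.1, .refl⟩

/-- `S` and its complement are the colour classes of a 2-dicolouring of `D` minus the arc `uv`,
with `u` and `v` in `S`. -/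
structure NearColouring (D : SimpleDigraph V) (u v : V) (S : Set V) : Prop where
  left_mem : u ∈ S
  right_mem : v ∈ S
  compl : ∀ a b c, a ∉ S → b ∉ S → c ∉ S → D.Adj a b → D.Adj b c → ¬ D.Adj c a
  between : ∀ c, D.Adj u c → D.Adj c v → c ∉ S
  left_triangle : ∀ b c, b ∈ S → c ∈ S → b ≠ v → D.Adj u b → D.Adj b c → ¬ D.Adj c u
  right_triangle : ∀ b c, b ∈ S → c ∈ S → c ≠ u → D.Adj v b → D.Adj b c → ¬ D.Adj c v
  back : D.Adj v u ∨ ∃ b, D.Adj v b ∧ D.Adj b u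

theorem Dicritical3.exists_nearColouring (hs : D.SemiComplete) (hd : D.Dicritical3) {u v : V}
    (huv : D.Adj u v) : ∃ S, NearColouring D u v S := by
  obtain ⟨φ, hφ⟩ := hd.2 Set.univ (fun a b => D.Adj a b ∧ ¬ (a = u ∧ b = v))
    (fun a b h => ⟨trivial, trivial, h.1⟩) (Or.inr fun h => by
      have h2 := congrFun (congrFun h u) v
      simp [huv] at h2)
  have hreach : φ u = φ v ∧ Relation.ReflTransGen
      (fun a b => (D.Adj a b ∧ ¬ (a = u ∧ b = v)) ∧ φ a = φ u ∧ φ b = φ u) v u := by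
    by_contra hcon
    refine hd.1 ⟨φ, fun i x hx => ?_⟩
    by_cases hi : φ u = i ∧ φ v = i
    · obtain ⟨rfl, hv⟩ := hi
      rcases transGen_insert_arc (A := fun a b => (D.Adj a b ∧ ¬ (a = u ∧ b = v)) ∧
        φ a = φ u ∧ φ b = φ u) (u := u) (v := v) (fun a b h => by tauto) hx with h | h
      · exact hφ _ x h
      · exact hcon ⟨hv.symm, h.2.trans h.1⟩
    · refine hφ i x (Relation.TransGen.mono (fun a b h => ⟨⟨h.1, ?_⟩, h.2⟩) x x hx)
      rintro ⟨rfl, rfl⟩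
      exact hi h.2
  obtain ⟨hc, hr⟩ := hreach
  have huv_ne := Adj.ne huv
  refine ⟨{x | φ x = φ u}, rfl, hc.symm, ?_, ?_, ?_, ?_, ?_⟩
  · intro a b c ha hb hc' hab hbc hca
    simp only [Set.mem_ofPred_eq] at ha hb hc'
    have hb' : φ b = φ a := by omega
    have hc'' : φ c = φ a := by omega
    exact (hφ (φ a)).no_triangle (a := a) (b := b) (c := c) (by grind) (by grind) (by grind)
  · intro c h1 h2 hcS
    have := Adj.ne h1
    have := Adj.ne h2
    exact hφ (φ u) u ((Relation.TransGen.single (b := c) (by grind)).tail (c := v)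
      (by grind) |>.trans_left hr)
  · intro b c hb hc' hne h1 h2 h3
    have := Adj.ne h1
    have := Adj.ne h3
    exact (hφ (φ u)).no_triangle (a := u) (b := b) (c := c) (by grind) (by grind) (by grind)
  · intro b c hb hc' hne h1 h2 h3
    have := Adj.ne h1
    have := Adj.ne h3
    exact (hφ (φ u)).no_triangle (a := v) (b := b) (c := c) (by grind) (by grind) (by grind)
  · rcases Relation.ReflTransGen.cases_head hr with h | ⟨b, hvb, hbu⟩
    · exact absurd h.symm huv_ne
    · by_cases hb : b = u
      · exact Or.inl (hb ▸ hvb.1.1)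
      · rcases hs b u hb with h | h
        · exact Or.inr ⟨b, hvb.1.1, h⟩
        · have := Adj.ne hvb.1.1
          exact absurd (Relation.TransGen.head' (a := u) (b := b)
            ⟨⟨h, by grind⟩, rfl, hvb.2.2⟩ hbu) (hφ (φ u) u)

/-- On a transitive subtournament, no vertex alternates in, out, in, out. -/
theorem Dicritical3.not_alternating (hs : D.SemiComplete) (hd : D.Dicritical3) {a b c d w : V}
    (hab : D.Adj a b) (hac : D.Adj a c) (had : D.Adj a d) (hbc : D.Adj b c) (hbd : D.Adj b d)
    (hcd : D.Adj c d) (haw : D.Adj a w) (hwb : D.Adj w b) (hcw : D.Adj c w) : ¬ D.Adj w d := by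
  intro hwd
  obtain ⟨S, h⟩ := hd.exists_nearColouring hs had
  exact h.compl w b c (h.between _ haw hwd) (h.between _ hab hbd) (h.between _ hac hcd) hwb hbc hcw

/-- A 3-dicritical semi-complete digraph contains no rotational tournament on 7 vertices. -/
theorem Dicritical3.not_rotational (hs : D.SemiComplete) (hd : D.Dicritical3) (c : ZMod 7 → V)
    (h1 : ∀ i, D.Adj (c i) (c (i + 1))) (h2 : ∀ i, D.Adj (c i) (c (i + 2)))
    (h3 : ∀ i, D.Adj (c i) (c (i + 3))) : False := by
  obtain ⟨S, h⟩ := hd.exists_nearColouring hs (h2 0)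
  have m1 : c 1 ∉ S := h.between _ (h1 0) (h1 1)
  have n3 : c 3 ≠ c 2 := (Adj.ne (h1 2)).symm
  have n6 : c 6 ≠ c 0 := Adj.ne (h1 6)
  by_cases m3 : c 3 ∈ S
  · have m4 : c 4 ∉ S := fun m => h.left_triangle _ _ m3 m n3 (h3 0) (h1 3) (h3 4)
    have m6 : c 6 ∉ S := fun m => h.left_triangle _ _ m3 m n3 (h3 0) (h3 3) (h1 6)
    exact h.compl _ _ _ m4 m6 m1 (h2 4) (h2 6) (h3 1)
  · by_cases m6 : c 6 ∈ S
    · have m5 : c 5 ∉ S := fun m => h.right_triangle _ _ m m6 n6 (h3 2) (h1 5) (h3 6)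
      exact h.compl _ _ _ m1 m3 m5 (h2 1) (h2 3) (h3 5)
    · exact h.compl _ _ _ m1 m3 m6 (h2 1) (h3 3) (h2 6)

/-- An interleaved sequence of arcs `y k → z k` of a transitive tournament, each completed to a
directed triangle by a vertex `w k`, cannot be homogeneous of length 4. -/
theorem Dicritical3.no_homogeneous_triangles (hs : D.SemiComplete) (hd : D.Dicritical3)
    (y z w : Fin 4 → V)
    (hyy : ∀ j k, j < k → D.Adj (y j) (y k)) (hyz : ∀ j k, j ≤ k → D.Adj (y j) (z k))
    (hzy : ∀ j k, j < k → D.Adj (z j) (y k)) (hzz : ∀ j k, j < k → D.Adj (z j) (z k))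
    (hwy : ∀ k, D.Adj (w k) (y k)) (hzw : ∀ k, D.Adj (z k) (w k))
    (hne : ∀ j k, w j ≠ z k)
    (hP : (∀ j k, j < k → D.Adj (w k) (y j)) ∨ (∀ j k, j < k → D.Adj (y j) (w k)))
    (hQ : (∀ j k, j < k → D.Adj (y k) (w j)) ∨ (∀ j k, j < k → D.Adj (w j) (y k)))
    (hR : (∀ j k, j < k → w j = w k) ∨ (∀ j k, j < k → D.Adj (w j) (w k)) ∨
      (∀ j k, j < k → D.Adj (w k) (w j))) : False := by
  have alt := fun {a b c d w : V} => hd.not_alternating hs (a := a) (b := b) (c := c) (d := d)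
    (w := w)
  by_cases hw : w 1 = w 2
  · have hw' : ∀ k, w k = w 1 := by
      rcases hR with h | h | h
      · intro k
        fin_cases k
        · exact h _ _ (by decide)
        · rfl
        · exact hw.symm
        · exact (h _ _ (by decide)).symm
      · exact absurd hw (Adj.ne (h _ _ (by decide)))
      · exact absurd hw.symm (Adj.ne (h _ _ (by decide)))
    refine alt (a := z 0) (b := y 1) (c := z 1) (d := y 2) (w := w 1) (hzy _ _ (by decide))
      (hzz _ _ (by decide)) (hzy _ _ (by decide)) (hyz _ _ (by decide)) (hyy _ _ (by decide))
      (hzy _ _ (by decide)) ?_ (hwy _) (hzw _) ?_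
    · exact hw' 0 ▸ hzw 0
    · exact hw' 2 ▸ hwy 2
  rcases hP with hP | hP <;> rcases hQ with hQ | hQ
  · rcases hR with hR | hR | hR
    · exact hw (hR _ _ (by decide))
    · refine hd.not_rotational hs ![y 0, y 1, y 2, y 3, w 0, w 1, w 2] ?_ ?_ ?_
      all_goals
        intro i
        fin_cases i
      · exact hyy 0 1 (by decide)
      · exact hyy 1 2 (by decide)
      · exact hyy 2 3 (by decide)
      · exact hQ 0 3 (by decide)
      · exact hR 0 1 (by decide)
      · exact hR 1 2 (by decide)
      · exact hP 0 2 (by decide)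
      · exact hyy 0 2 (by decide)
      · exact hyy 1 3 (by decide)
      · exact hQ 0 2 (by decide)
      · exact hQ 1 3 (by decide)
      · exact hR 0 2 (by decide)
      · exact hP 0 1 (by decide)
      · exact hP 1 2 (by decide)
      · exact hyy 0 3 (by decide)
      · exact hQ 0 1 (by decide)
      · exact hQ 1 2 (by decide)
      · exact hQ 2 3 (by decide)
      · exact hwy 0
      · exact hwy 1
      · exact hwy 2
    · obtain ⟨S, h⟩ := hd.exists_nearColouring hs (hP 1 2 (by decide))
      have m0 : y 0 ∉ S := h.between _ (hP 0 2 (by decide)) (hyy 0 1 (by decide))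
      have m1 : w 1 ∉ S := h.between _ (hR 1 2 (by decide)) (hwy 1)
      have mem : ∀ p, 1 < p → y p ∈ S := fun p hp => by
        by_contra m
        exact h.compl _ _ _ m0 m m1 (hyy 0 p (by omega)) (hQ 1 p hp) (hP 0 1 (by decide))
      exact h.left_triangle _ _ (mem 2 (by decide)) (mem 3 (by decide))
        (Adj.ne (hyy 1 2 (by decide))).symm (hwy 2) (hyy 2 3 (by decide)) (hQ 2 3 (by decide))
  · have hwz : ∀ j k, j ≠ k → j < 3 → k < 3 → D.Adj (w j) (z k) := by
      intro j k hjk hj hk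
      refine (hs _ _ (hne j k)).resolve_right fun hcon => ?_
      rcases lt_or_gt_of_ne hjk with hlt | hlt
      · exact alt (hzy j k hlt) (hzz j k hlt) (hzy j 3 (by omega)) (hyz k k le_rfl)
          (hyy k 3 hk) (hzy k 3 hk) (hzw j) (hQ j k hlt) hcon (hQ j 3 (by omega))
      · exact alt (hzy k j hlt) (hzz k j hlt) (hzy k 3 hk) (hyz j j le_rfl)
          (hyy j 3 hj) (hzy j 3 hj) hcon (hwy j) (hzw j) (hQ j 3 hj)
    have key : ∀ j k, j ≠ k → 0 < j → j < 3 → 0 < k → k < 3 → ¬ D.Adj (w j) (w k) := by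
      intro j k hjk hj hj3 hk hk3 hadj
      obtain ⟨S, h⟩ := hd.exists_nearColouring hs (hQ j 3 hj3)
      have m0 : y 0 ∉ S := h.between _ (hP 0 j hj) (hyy 0 3 (by decide))
      have mk : z k ∉ S := h.between _ (hwz j k hjk hj3 hk3) (hzy k 3 hk3)
      have mw : w k ∉ S := h.between _ hadj (hQ k 3 hk3)
      exact h.compl _ _ _ mk mw m0 (hzw k) (hP 0 k hk) (hyz 0 k (by omega))
    exact (hs _ _ hw).elim (key 1 2 (by decide) (by decide) (by decide) (by decide) (by decide))
      (key 2 1 (by decide) (by decide) (by decide) (by decide) (by decide))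
  · have key : ∀ j k, j ≠ k → 0 < j → j < 3 → 0 < k → k < 3 → ¬ D.Adj (w j) (w k) := by
      intro j k hjk hj hj3 hk hk3 hadj
      obtain ⟨S, h⟩ := hd.exists_nearColouring hs (hP 0 k hk)
      have hjk' : D.Adj (y j) (w k) :=
        (lt_or_gt_of_ne hjk).elim (hP j k) (hQ k j)
      have mj : y j ∉ S := h.between _ (hyy 0 j hj) hjk'
      have m3 : y 3 ∉ S := h.between _ (hyy 0 3 (by decide)) (hQ k 3 hk3)
      have mw : w j ∉ S := h.between _ (hP 0 j hj) hadj
      exact h.compl _ _ _ mw mj m3 (hwy j) (hyy j 3 hj3) (hQ j 3 hj3)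
    exact (hs _ _ hw).elim (key 1 2 (by decide) (by decide) (by decide) (by decide) (by decide))
      (key 2 1 (by decide) (by decide) (by decide) (by decide) (by decide))
  · exact alt (hyy 0 1 (by decide)) (hyz 0 1 (by decide)) (hyy 0 2 (by decide)) (hyz 1 1 le_rfl)
      (hyy 1 2 (by decide)) (hzy 1 2 (by decide)) (hP 0 1 (by decide)) (hwy 1) (hzw 1)
      (hQ 1 2 (by decide))

/-- The order of transitive subtournaments of 3-dicritical semi-complete digraphs is bounded. -/
theorem exists_transitive_bound : ∃ M : ℕ, ∀ (V : Type) (D : SimpleDigraph V),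
    D.SemiComplete → D.Dicritical3 → ∀ t : ℕ → V,
      (∀ i j, i < j → j < 2 * M → D.Adj (t i) (t j) ∧ ¬ D.Adj (t j) (t i)) → False := by
  classical
  obtain ⟨M, hM⟩ := exists_homogeneous (Prop × Prop × Prop × Prop) 4
  refine ⟨M, fun V D hs hd t ht => ?_⟩
  have hw : ∀ k, ∃ w, k < M → D.Adj w (t (2 * k)) ∧ D.Adj (t (2 * k + 1)) w := by
    intro k
    by_cases hk : k < M
    · obtain ⟨h1, h2⟩ := ht (2 * k) (2 * k + 1) (by omega) (by omega)
      obtain ⟨S, h⟩ := hd.exists_nearColouring hs h1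
      obtain ⟨b, hb⟩ := h.back.resolve_left h2
      exact ⟨b, fun _ => hb.symm⟩
    · exact ⟨t 0, fun h => absurd h hk⟩
  choose w hw using hw
  have hne : ∀ k i, k < M → i < 2 * M → w k ≠ t i := by
    intro k i hk hi h
    obtain ⟨h1, h2⟩ := hw k hk
    rw [h] at h1 h2
    have hlt : i < 2 * k := by
      by_contra hcon
      rcases eq_or_lt_of_le (not_lt.mp hcon) with h' | h'
      · exact D.loopless _ (h' ▸ h1)
      · exact (ht _ _ h' hi).2 h1
    exact (ht i (2 * k + 1) (by omega) (by omega)).2 h2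
  obtain ⟨f, x, hf, hfM, hx, hfx⟩ := hM fun j k =>
    (D.Adj (w k) (t (2 * j)), D.Adj (t (2 * k)) (w j), D.Adj (w j) (w k), w j = w k)
  have hle : ∀ j k, j ≤ k → f j ≤ f k := fun j k h => hf.monotone h
  have hc := fun i j (hij : i < j) => hx (hfx i j hij) (hfx 0 1 (by decide))
  simp only [Prod.mk.injEq, eq_iff_iff] at hc
  refine hd.no_homogeneous_triangles hs (fun k => t (2 * f k)) (fun k => t (2 * f k + 1))
    (fun k => w (f k)) ?_ ?_ ?_ ?_ (fun k => (hw _ (hfM k)).1) (fun k => (hw _ (hfM k)).2)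
    ?_ ?_ ?_ ?_
  · exact fun j k h => (ht _ _ (by have := hf h; omega) (by have := hfM k; omega)).1
  · exact fun j k h => (ht _ _ (by have := hle _ _ h; omega) (by have := hfM k; omega)).1
  · exact fun j k h => (ht _ _ (by have := hf h; omega) (by have := hfM k; omega)).1
  · exact fun j k h => (ht _ _ (by have := hf h; omega) (by have := hfM k; omega)).1
  · exact fun j k => hne _ _ (hfM j) (by have := hfM k; omega)
  · by_cases h : D.Adj (w (f 1)) (t (2 * f 0))
    · exact Or.inl fun j k hjk => (hc j k hjk).1.mpr h
    · exact Or.inr fun j k hjk => (hs _ _ (hne _ _ (hfM k) (by have := hfM j; omega))).resolve_left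
        fun h' => h ((hc j k hjk).1.mp h')
  · by_cases h : D.Adj (t (2 * f 1)) (w (f 0))
    · exact Or.inl fun j k hjk => (hc j k hjk).2.1.mpr h
    · exact Or.inr fun j k hjk => (hs _ _ (hne _ _ (hfM j) (by have := hfM k; omega))).resolve_right
        fun h' => h ((hc j k hjk).2.1.mp h')
  · by_cases h : w (f 0) = w (f 1)
    · exact Or.inl fun j k hjk => (hc j k hjk).2.2.2.mpr h
    · right
      by_cases h2 : D.Adj (w (f 0)) (w (f 1))
      · exact Or.inl fun j k hjk => (hc j k hjk).2.2.1.mpr h2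
      · exact Or.inr fun j k hjk => (hs _ _ fun h' => h ((hc j k hjk).2.2.2.mp h')).resolve_left
          fun h' => h2 ((hc j k hjk).2.2.1.mp h')

/-- A finite set inducing no digon and no directed triangle can be enumerated transitively. -/
theorem SemiComplete.exists_transitive_enumeration (hs : D.SemiComplete) (T : Finset V)
    (h2 : ∀ a ∈ T, ∀ b ∈ T, D.Adj a b → ¬ D.Adj b a)
    (h3 : ∀ a ∈ T, ∀ b ∈ T, ∀ c ∈ T, D.Adj a b → D.Adj b c → ¬ D.Adj c a) :
    ∃ t : Fin T.card → V, ∀ i j, i < j → D.Adj (t i) (t j) ∧ ¬ D.Adj (t j) (t i) := by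
  classical
  let r : T → T → Prop := fun a b => D.Adj a b
  have : IsStrictTotalOrder T r :=
    { irrefl := fun a => D.loopless _
      trans := fun a b c hab hbc => by
        by_cases hac : a = c
        · exact absurd (hac ▸ hbc) (h2 _ a.2 _ b.2 hab)
        · exact (hs a c fun h => hac (Subtype.ext h)).resolve_right
            (h3 _ a.2 _ b.2 _ c.2 hab hbc)
      trichotomous := fun a b hab hba => by
        by_contra hne
        exact (hs a b fun h => hne (Subtype.ext h)).elim hab hba }
  let : LinearOrder T := linearOrderOfSTO r
  let e := Fintype.orderIsoFinOfCardEq T (Fintype.card_coe T)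
  refine ⟨fun i => e i, fun i j hij => ?_⟩
  have hadj : D.Adj (e i) (e j) := e.strictMono hij
  exact ⟨hadj, h2 _ (e i).2 _ (e j).2 hadj⟩

theorem exists_card_bound : ∃ B : ℕ, ∀ (V : Type) [Fintype V] (D : SimpleDigraph V),
    D.SemiComplete → D.Dicritical3 → Fintype.card V ≤ B := by
  classical
  obtain ⟨M, hM⟩ := exists_transitive_bound
  refine ⟨2 * (2 * M) + 1, fun V _ D hs hd => ?_⟩
  by_contra! hlt
  have : Nonempty V := Fintype.card_pos_iff.mp (by omega)
  obtain ⟨v⟩ := this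
  obtain ⟨φ, hφ⟩ := hd.2 {v}ᶜ (fun a b => D.Adj a b ∧ a ≠ v ∧ b ≠ v)
    (fun a b h => ⟨h.2.1, h.2.2, h.1⟩) (Or.inl fun h => by
      have : v ∈ ({v}ᶜ : Set V) := h ▸ Set.mem_univ v
      exact this rfl)
  obtain ⟨i, -, hi⟩ := Finset.exists_lt_card_fiber_of_mul_lt_card_of_maps_to
    (s := Finset.univ.erase v) (t := Finset.univ) (f := φ) (n := 2 * M)
    (fun _ _ => Finset.mem_univ _) (by
      rw [Finset.card_erase_of_mem (Finset.mem_univ v), Finset.card_univ, Finset.card_univ,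
        Fintype.card_fin]
      omega)
  set T := (Finset.univ.erase v).filter fun x => φ x = i
  have hT : ∀ a ∈ T, a ≠ v ∧ φ a = i := fun a ha => by simpa [T] using ha
  have harc : ∀ a ∈ T, ∀ b ∈ T, D.Adj a b →
      (D.Adj a b ∧ a ≠ v ∧ b ≠ v) ∧ φ a = i ∧ φ b = i := fun a ha b hb hab =>
    ⟨⟨hab, (hT a ha).1, (hT b hb).1⟩, (hT a ha).2, (hT b hb).2⟩
  obtain ⟨t, ht⟩ := hs.exists_transitive_enumeration T
    (fun a ha b hb hab hba => (hφ i).no_digon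
      (harc a ha b hb hab) (harc b hb a ha hba))
    (fun a ha b hb c hc hab hbc hca => (hφ i).no_triangle
      (harc a ha b hb hab) (harc b hb c hc hbc) (harc c hc a ha hca))
  refine hM V D hs hd (fun k => if hk : k < T.card then t ⟨k, hk⟩ else v) fun k l hkl hl => ?_
  rw [dif_pos (by omega), dif_pos (by omega)]
  exact ht _ _ hkl

instance (n : ℕ) : Finite (SimpleDigraph (Fin n)) :=
  Finite.of_injective SimpleDigraph.Adj fun D E h => by cases D; cases E; congr

end SimpleDigraph

/-- There are only finitely many 3-dicritical semi-complete digraphs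
up to isomorphism: there is a finite list of digraphs such that every (finite)
3-dicritical semi-complete digraph is isomorphic to one of them. -/
theorem finitely_many_dicritical3_semicomplete :
    ∃ (k : ℕ) (F : Fin k → Σ n : ℕ, SimpleDigraph (Fin n)),
      ∀ (V : Type) [Fintype V] (D : SimpleDigraph V),
        D.SemiComplete → D.Dicritical3 → ∃ i : Fin k, D.Iso (F i).2 := by
  obtain ⟨B, hB⟩ := SimpleDigraph.exists_card_bound
  obtain ⟨k, ⟨e⟩⟩ := Finite.exists_equiv_fin (Σ n : Fin (B + 1), SimpleDigraph (Fin n))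
  refine ⟨k, fun i => ⟨(e.symm i).1, (e.symm i).2⟩, fun V _ D hs hd => ?_⟩
  let g := Fintype.equivFin V
  refine ⟨e ⟨⟨Fintype.card V, Nat.lt_succ_of_le (hB V D hs hd)⟩,
    ⟨fun a b => D.Adj (g.symm a) (g.symm b), fun a => D.loopless _⟩⟩, ?_⟩
  beta_reduce
  rw [Equiv.symm_apply_apply]
  exact ⟨g, fun u v => by simp⟩
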